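/- arXiv:1506.05520 — 2 statements merged into one kernel-verified Lean document; each statement's English description precedes it below -/
import Mathlib

section
/- For every time step τ > 0 and every ν₀ ∈ X_R, the functional ν ↦ (1/(2τ))·d²(ν, ν₀) + J(ν) attains its minimum over X_R; i.e. there exists ν* ∈ X_R with (1/(2τ))d²(ν*, ν₀) + J(ν*) ≤ (1/(2τ))d²(ν, ν₀) + J(ν) for all ν ∈ X_R. -/
open MeasureTheory Filter

noncomputable section

/-- Optimal transport cost between two Borel measures on `E` for the cost `c`:
the infimum of `∫ c(x,y) dγ` over all transport plans `γ` with marginals `ν` and `θ`. -/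
def Wcost {E : Type*} [MeasurableSpace E] (c : E → E → ℝ) (ν θ : Measure E) : ℝ :=
  sInf { r : ℝ | ∃ γ : Measure (E × E),
    γ.map Prod.fst = ν ∧ γ.map Prod.snd = θ ∧ r = ∫ p, c p.1 p.2 ∂γ }

/-- Squared 2-Wasserstein distance between measures (of equal mass) on `ℝ`. -/
def W2sq (ν θ : Measure ℝ) : ℝ := Wcost (fun x y => (x - y) ^ 2) ν θ

/-- Squared 2-Wasserstein distance between measures on `ℝ × ℝ` (Euclidean cost). -/
def W2sqProd (ν θ : Measure (ℝ × ℝ)) : ℝ :=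
  Wcost (fun p q => (p.1 - q.1) ^ 2 + (p.2 - q.2) ^ 2) ν θ

/-- The measure `ν ⊗ μ` on `A × ℝ` associated with a family `ν = (ν^a)` of measures on `ℝ`:
`∫ φ d(ν⊗μ) = ∫_A ∫_ℝ φ(a,x) dν^a(x) dμ(a)`. -/
def nuOtimes (μ : Measure ℝ) (ν : ℝ → Measure ℝ) : Measure (ℝ × ℝ) :=
  μ.bind fun a => (ν a).map fun x => (a, x)

/-- Membership in `X_R`: a `μ`-measurable family `ν = (ν^a)` of nonnegative measures on `ℝ`
with total mass `h a` for `μ`-a.e. `a` and support in `[-R, R]` for `μ`-a.e. `a`. -/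
structure IsXR (μ : Measure ℝ) (h : ℝ → ℝ) (R : ℝ) (ν : ℝ → Measure ℝ) : Prop where
  meas : ∀ s : Set ℝ, MeasurableSet s → Measurable fun a => ν a s
  mass : ∀ᵐ a ∂μ, ν a Set.univ = ENNReal.ofReal (h a)
  supp : ∀ᵐ a ∂μ, ν a ((Set.Icc (-R) R)ᶜ) = 0

/-- The measure `ν̄ = ∫_A ν^a dμ(a)` (second marginal of `ν ⊗ μ`). -/
def barNu (μ : Measure ℝ) (ν : ℝ → Measure ℝ) : Measure ℝ := (nuOtimes μ ν).map Prod.snd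

/-- The interaction part `J₀(ν) = ∫∫ |x−y| d(ν⊗μ)(a,x) d(ν⊗μ)(b,y)`. -/
def J0 (μ : Measure ℝ) (ν : ℝ → Measure ℝ) : ℝ :=
  ∫ q, |q.1.2 - q.2.2| ∂((nuOtimes μ ν).prod (nuOtimes μ ν))

/-- The potential part `J₁(ν) = ∫ (1/2 − a)·x d(ν⊗μ)(a,x)`. -/
def J1 (μ : Measure ℝ) (ν : ℝ → Measure ℝ) : ℝ :=
  ∫ p, (1 / 2 - p.1) * p.2 ∂(nuOtimes μ ν)

/-- The energy `J = (1/4)·J₀ + J₁`. -/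
def Jen (μ : Measure ℝ) (ν : ℝ → Measure ℝ) : ℝ := (1 / 4) * J0 μ ν + J1 μ ν

/-- The squared distance `d²(ν, θ) = ∫_A W₂²(ν^a, θ^a) dμ(a)` on `X_R`. -/
def dsq (μ : Measure ℝ) (ν θ : ℝ → Measure ℝ) : ℝ := ∫ a, W2sq (ν a) (θ a) ∂μ

/-- The weak distance `d_w(ν, θ) = W₂(ν⊗μ, θ⊗μ)`. -/
def dw (μ : Measure ℝ) (ν θ : ℝ → Measure ℝ) : ℝ :=
  Real.sqrt (W2sqProd (nuOtimes μ ν) (nuOtimes μ θ))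

/-- A `μ`-measurable family of transport plans `γ^a ∈ Π(ν^a, θ^a)`. -/
structure IsPlanFamily (μ : Measure ℝ) (ν θ : ℝ → Measure ℝ)
    (γ : ℝ → Measure (ℝ × ℝ)) : Prop where
  meas : ∀ s : Set (ℝ × ℝ), MeasurableSet s → Measurable fun a => γ a s
  fst : ∀ᵐ a ∂μ, (γ a).map Prod.fst = ν a
  snd : ∀ᵐ a ∂μ, (γ a).map Prod.snd = θ a

/-- `w ∈ ∂J(ν)`: `w ∈ L¹(ν⊗μ)` and for every `R' > 0`, every `θ ∈ X_{R'}` and every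
`μ`-measurable family of plans `γ^a ∈ Π(ν^a, θ^a)`,
`J(θ) − J(ν) ≥ ∫_A ∫ w^a(y)(z − y) dγ^a(y,z) dμ(a)`. -/
def InSubdiff (μ : Measure ℝ) (h : ℝ → ℝ) (ν : ℝ → Measure ℝ) (w : ℝ → ℝ → ℝ) : Prop :=
  Integrable (fun p : ℝ × ℝ => w p.1 p.2) (nuOtimes μ ν) ∧
  ∀ R' : ℝ, 0 < R' → ∀ θ : ℝ → Measure ℝ, IsXR μ h R' θ →
    ∀ γ : ℝ → Measure (ℝ × ℝ), IsPlanFamily μ ν θ γ →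
      Jen μ θ - Jen μ ν ≥ ∫ a, (∫ p : ℝ × ℝ, w a p.1 * (p.2 - p.1) ∂(γ a)) ∂μ

/-- Cumulative distribution function `G(x) = ρ((−∞, x])` of `ρ = ∫_A ν^a dμ(a)`. -/
def Gcdf (μ : Measure ℝ) (ν : ℝ → Measure ℝ) (x : ℝ) : ℝ := (barNu μ ν (Set.Iic x)).toReal

/-- Left-continuous version `G⁻(x) = ρ((−∞, x))`. -/
def GcdfM (μ : Measure ℝ) (ν : ℝ → Measure ℝ) (x : ℝ) : ℝ := (barNu μ ν (Set.Iio x)).toReal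

/-- The curve `t ↦ ν_t` solves the continuity equation `∂ₜν + ∂ₓ(ν v) = 0` on `[0,T]`
in the sense of distributions. -/
def SolvesContinuity (T : ℝ) (νa : ℝ → Measure ℝ) (va : ℝ → ℝ → ℝ) : Prop :=
  ∀ φ : ℝ → ℝ → ℝ, ContDiff ℝ 1 (Function.uncurry φ) →
    HasCompactSupport (Function.uncurry φ) →
    (∫ t in Set.Icc (0 : ℝ) T,
        ∫ x, (deriv (fun s => φ s x) t + deriv (fun y => φ t y) x * va t x) ∂(νa t))
      = (∫ x, φ T x ∂(νa T)) - ∫ x, φ 0 x ∂(νa 0)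

/-- A gradient flow of `J` on `[0,T]` starting from `ν₀`: a Lipschitz (for `d`) curve
`t ↦ ν(t) ∈ X_R` with a velocity `v(t) ∈ −∂J(ν(t))` for a.e. `t`, such that for `μ`-a.e.
label `a` the curve `t ↦ ν(t)^a` solves the continuity equation with velocity `v^a`. -/
structure IsGradientFlow (μ : Measure ℝ) (h : ℝ → ℝ) (R T : ℝ)
    (ν : ℝ → ℝ → Measure ℝ) (v : ℝ → ℝ → ℝ → ℝ) (ν₀ : ℝ → Measure ℝ) : Prop where
  init : ν 0 = ν₀
  mem : ∀ t ∈ Set.Icc (0 : ℝ) T, IsXR μ h R (ν t)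
  lip : ∃ L : ℝ, ∀ s ∈ Set.Icc (0 : ℝ) T, ∀ t ∈ Set.Icc (0 : ℝ) T,
    Real.sqrt (dsq μ (ν s) (ν t)) ≤ L * |t - s|
  vmeas : Measurable fun p : ℝ × ℝ × ℝ => v p.1 p.2.1 p.2.2
  subdiff : ∀ᵐ t ∂(volume.restrict (Set.Icc (0 : ℝ) T)),
    InSubdiff μ h (ν t) fun a x => -(v t a x)
  cont : ∀ᵐ a ∂μ, SolvesContinuity T (fun t => ν t a) fun t => v t a

end

open Set Topology
open scoped RealInnerProductSpace ENNReal

/-- A convex functional perturbed by a squared distance attains its minimum on a closed set. -/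
lemma exists_minimizer_sq_dist_add {E : Type*} [NormedAddCommGroup E] [InnerProductSpace ℝ E]
    [CompleteSpace E] {K : Set E} (hKc : IsClosed K) (hne : K.Nonempty) {Φ : E → ℝ}
    (hΦ : ConvexOn ℝ K Φ) (hcont : Continuous Φ) {b : ℝ} (hb : ∀ x ∈ K, b ≤ Φ x)
    {c : ℝ} (hc : 0 < c) (x₀ : E) :
    ∃ x ∈ K, ∀ y ∈ K, c * ‖x - x₀‖ ^ 2 + Φ x ≤ c * ‖y - x₀‖ ^ 2 + Φ y := by
  set F : E → ℝ := fun x => c * ‖x - x₀‖ ^ 2 + Φ x with hF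
  have hFcont : Continuous F := by fun_prop
  have hbdd : BddBelow (F '' K) := by
    refine ⟨b, ?_⟩
    rintro _ ⟨x, hx, rfl⟩
    have := hb x hx
    have : 0 ≤ c * ‖x - x₀‖ ^ 2 := by positivity
    simp only [hF]; linarith
  set d := sInf (F '' K)
  have hd : ∀ x ∈ K, d ≤ F x := fun x hx => csInf_le hbdd (mem_image_of_mem F hx)
  have key : ∀ x ∈ K, ∀ y ∈ K, c / 4 * ‖x - y‖ ^ 2 ≤ (F x - d) / 2 + (F y - d) / 2 := by
    intro x hx y hy
    have hmid := hd _ (hΦ.1 hx hy (by norm_num : (0 : ℝ) ≤ 1 / 2) (by norm_num : (0 : ℝ) ≤ 1 / 2)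
      (by norm_num))
    have hconv := hΦ.2 hx hy (by norm_num : (0 : ℝ) ≤ 1 / 2) (by norm_num : (0 : ℝ) ≤ 1 / 2)
      (by norm_num)
    have hpar := parallelogram_law_with_norm ℝ (x - x₀) (y - x₀)
    have e1 : x - x₀ - (y - x₀) = x - y := by abel
    have e2 : ((1 / 2 : ℝ) • x + (1 / 2 : ℝ) • y) - x₀
        = (1 / 2 : ℝ) • ((x - x₀) + (y - x₀)) := by module
    have e3 : ‖((1 / 2 : ℝ) • x + (1 / 2 : ℝ) • y) - x₀‖ ^ 2
        = 1 / 4 * ‖(x - x₀) + (y - x₀)‖ ^ 2 := by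
      rw [e2, norm_smul, mul_pow]; norm_num
    rw [e1] at hpar
    simp only [hF, smul_eq_mul] at hmid hconv ⊢
    rw [e3] at hmid
    nlinarith
  have hex : ∀ n : ℕ, ∃ x ∈ K, F x < d + 1 / ((n : ℝ) + 1) := by
    intro n
    obtain ⟨_, ⟨x, hx, rfl⟩, hlt⟩ := exists_lt_of_csInf_lt (hne.image F)
      (lt_add_of_pos_right d (Nat.one_div_pos_of_nat (α := ℝ) (n := n)))
    exact ⟨x, hx, hlt⟩
  choose u huK hu using hex
  have hcau : CauchySeq u := by
    refine Metric.cauchySeq_iff.2 fun ε hε => ?_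
    obtain ⟨N, hN⟩ := exists_nat_one_div_lt (show 0 < c / 4 * ε ^ 2 by positivity)
    refine ⟨N, fun m hm n hn => ?_⟩
    have hk := key _ (huK m) _ (huK n)
    have h1 := hu m
    have h2 := hu n
    have h3 := Nat.one_div_le_one_div (α := ℝ) hm
    have h4 := Nat.one_div_le_one_div (α := ℝ) hn
    rw [dist_eq_norm]
    have : c / 4 * ‖u m - u n‖ ^ 2 < c / 4 * ε ^ 2 := by linarith
    exact lt_of_pow_lt_pow_left₀ 2 hε.le (lt_of_mul_lt_mul_left this (by positivity))
  obtain ⟨x, hx⟩ := cauchySeq_tendsto_of_complete hcau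
  refine ⟨x, hKc.mem_of_tendsto hx (Eventually.of_forall huK), fun y hy => ?_⟩
  have hlim : Tendsto (fun n : ℕ => d + 1 / ((n : ℝ) + 1)) atTop (𝓝 (d + 0)) :=
    tendsto_const_nhds.add tendsto_one_div_add_atTop_nhds_zero_nat
  have : F x ≤ d + 0 :=
    le_of_tendsto_of_tendsto' ((hFcont.tendsto x).comp hx) hlim fun n => (hu n).le
  exact (this.trans_eq (add_zero d)).trans (hd y hy)

section Lp

variable {Ω : Type*} [MeasurableSpace Ω] {P : Measure Ω}

lemma continuous_integral_abs_Lp [IsFiniteMeasure P] :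
    Continuous fun g : Lp ℝ 2 P => ∫ p, |g p| ∂P := by
  have : (fun g : Lp ℝ 2 P => ∫ p, |g p| ∂P)
      = fun g : Lp ℝ 2 P => ⟪Lp.const 2 P (1 : ℝ), |g|⟫ := by
    ext g
    rw [L2.inner_def]
    refine integral_congr_ae ?_
    filter_upwards [Lp.coeFn_abs g, Lp.coeFn_const (p := 2) (μ := P) (1 : ℝ)] with p h1 h2
    rw [h1, h2]
    simp
  rw [this]
  have habs : Continuous fun g : Lp ℝ 2 P => |g| := by
    unfold abs; fun_prop
  fun_prop

lemma convexOn_integral_abs_Lp [IsFiniteMeasure P] :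
    ConvexOn ℝ univ fun g : Lp ℝ 2 P => ∫ p, |g p| ∂P := by
  have hint : ∀ g : Lp ℝ 2 P, Integrable (fun p => |g p|) P := fun g =>
    ((Lp.memLp g).integrable (by norm_num)).abs
  refine ⟨convex_univ, fun f _ g _ a b ha hb _ => ?_⟩
  calc ∫ p, |(a • f + b • g : Lp ℝ 2 P) p| ∂P
      ≤ ∫ p, (a * |f p| + b * |g p|) ∂P := by
        refine integral_mono_ae (hint _) (((hint f).const_mul a).add ((hint g).const_mul b)) ?_
        filter_upwards [Lp.coeFn_add (a • f) (b • g), Lp.coeFn_smul a f, Lp.coeFn_smul b g]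
          with p h1 h2 h3
        simp only [h1, Pi.add_apply, h2, h3, Pi.smul_apply, smul_eq_mul]
        refine (abs_add_le _ _).trans_eq ?_
        rw [abs_mul, abs_mul, abs_of_nonneg ha, abs_of_nonneg hb]
    _ = a • ∫ p, |f p| ∂P + b • ∫ p, |g p| ∂P := by
        rw [integral_add ((hint f).const_mul a) ((hint g).const_mul b), integral_const_mul,
          integral_const_mul, smul_eq_mul, smul_eq_mul]

/-- The interaction-plus-potential energy of a function `X` on `(Ω, P)`. -/
noncomputable def pairEnergy (P : Measure Ω) (w X : Ω → ℝ) : ℝ :=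
  1 / 4 * ∫ q, |X q.1 - X q.2| ∂(P.prod P) + ∫ p, w p * X p ∂P

/-- The difference map `f ↦ ((p, q) ↦ f p - f q)` on `L²`. -/
noncomputable def diffLp (P : Measure Ω) [IsProbabilityMeasure P] : Lp ℝ 2 P →L[ℝ] Lp ℝ 2 (P.prod P) :=
  (Lp.compMeasurePreservingₗᵢ ℝ Prod.fst
      (measurePreserving_fst (μ := P) (ν := P))).toContinuousLinearMap
    - (Lp.compMeasurePreservingₗᵢ ℝ Prod.snd
      (measurePreserving_snd (μ := P) (ν := P))).toContinuousLinearMap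

lemma coeFn_diffLp [IsProbabilityMeasure P] (f : Lp ℝ 2 P) :
    diffLp P f =ᵐ[P.prod P] fun q => f q.1 - f q.2 := by
  have e : diffLp P f = Lp.compMeasurePreserving Prod.fst measurePreserving_fst f
      - Lp.compMeasurePreserving Prod.snd measurePreserving_snd f := rfl
  rw [e]
  filter_upwards [Lp.coeFn_sub (Lp.compMeasurePreserving Prod.fst
      (measurePreserving_fst (μ := P) (ν := P)) f)
      (Lp.compMeasurePreserving Prod.snd measurePreserving_snd f),
    Lp.coeFn_compMeasurePreserving f (measurePreserving_fst (μ := P) (ν := P)),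
    Lp.coeFn_compMeasurePreserving f (measurePreserving_snd (μ := P) (ν := P))] with q h1 h2 h3
  rw [h1, Pi.sub_apply, h2, h3]; rfl

lemma pairEnergy_congr [SFinite P] {w w' X Y : Ω → ℝ} (h : X =ᵐ[P] Y) (hw : w =ᵐ[P] w') :
    pairEnergy P w X = pairEnergy P w' Y := by
  unfold pairEnergy
  congr 1
  · congr 1
    refine integral_congr_ae ?_
    filter_upwards [Measure.quasiMeasurePreserving_fst.ae h,
      Measure.quasiMeasurePreserving_snd.ae h] with q h1 h2
    rw [h1, h2]
  · refine integral_congr_ae ?_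
    filter_upwards [h, hw] with p h1 h2
    rw [h1, h2]

lemma pairEnergy_Lp [IsProbabilityMeasure P] (w f : Lp ℝ 2 P) :
    pairEnergy P w f = 1 / 4 * ∫ q, |diffLp P f q| ∂(P.prod P) + ⟪w, f⟫ := by
  unfold pairEnergy
  rw [L2.inner_def]
  congr 2
  · refine integral_congr_ae ?_
    filter_upwards [coeFn_diffLp f] with q h
    rw [h]
  · simp [mul_comm]

lemma sq_norm_sub_toLp {f g : Ω → ℝ} (hf : MemLp f 2 P) (hg : MemLp g 2 P) :
    ‖hf.toLp f - hg.toLp g‖ ^ 2 = ∫ p, (f p - g p) ^ 2 ∂P := by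
  rw [← real_inner_self_eq_norm_sq, ← MemLp.toLp_sub, L2.inner_def]
  refine integral_congr_ae ?_
  filter_upwards [(hf.sub hg).coeFn_toLp] with p h
  simp [h, sq]

/-- A squared `L²` distance plus a pair energy attains its minimum among measurable functions
with values in `[-R, R]`. -/
lemma exists_minimizer_sq_sub_add_pairEnergy [IsProbabilityMeasure P] {c R : ℝ} (hc : 0 < c)
    (hR : 0 ≤ R) {X₀ w : Ω → ℝ} (hX₀ : MemLp X₀ 2 P) (hw : MemLp w 2 P) :
    ∃ X : Ω → ℝ, Measurable X ∧ (∀ p, X p ∈ Icc (-R) R) ∧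
      ∀ Y : Ω → ℝ, Measurable Y → (∀ p, Y p ∈ Icc (-R) R) →
        c * ∫ p, (X p - X₀ p) ^ 2 ∂P + pairEnergy P w X
          ≤ c * ∫ p, (Y p - X₀ p) ^ 2 ∂P + pairEnergy P w Y := by
  set K : Set (Lp ℝ 2 P) := Icc (Lp.const 2 P (-R)) (Lp.const 2 P R) with hK
  have memK : ∀ f : Lp ℝ 2 P, f ∈ K ↔ ∀ᵐ p ∂P, f p ∈ Icc (-R) R := by
    intro f
    rw [hK, mem_Icc, ← Lp.coeFn_le, ← Lp.coeFn_le]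
    constructor
    · rintro ⟨h1, h2⟩
      filter_upwards [h1, h2, Lp.coeFn_const (p := 2) (μ := P) R,
        Lp.coeFn_const (p := 2) (μ := P) (-R)] with p h1 h2 h3 h4
      rw [h4] at h1; rw [h3] at h2
      exact ⟨h1, h2⟩
    · intro h
      constructor
      · filter_upwards [h, Lp.coeFn_const (p := 2) (μ := P) (-R)] with p h h4
        rw [h4]; exact h.1
      · filter_upwards [h, Lp.coeFn_const (p := 2) (μ := P) R] with p h h4
        rw [h4]; exact h.2
  have hconv : Convex ℝ K := by
    intro f hf g hg a b ha hb hab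
    rw [memK] at hf hg ⊢
    filter_upwards [Lp.coeFn_add (a • f) (b • g), Lp.coeFn_smul a f, Lp.coeFn_smul b g, hf, hg]
      with p h1 h2 h3 h4 h5
    simp only [h1, Pi.add_apply, h2, h3, Pi.smul_apply]
    exact convex_Icc (-R) R h4 h5 ha hb hab
  have hmemLp : ∀ Y : Ω → ℝ, Measurable Y → (∀ p, Y p ∈ Icc (-R) R) → MemLp Y 2 P :=
    fun Y hY hYR => MemLp.of_bound hY.aestronglyMeasurable R
      (Eventually.of_forall fun p => abs_le.2 (hYR p))
  have htoLp : ∀ (Y : Ω → ℝ) (hY : MemLp Y 2 P), (∀ p, Y p ∈ Icc (-R) R) → hY.toLp ∈ K := by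
    intro Y hY hYR
    rw [memK]
    filter_upwards [hY.coeFn_toLp] with p h
    rw [h]; exact hYR p
  set Φ : Lp ℝ 2 P → ℝ := fun f =>
    1 / 4 * ∫ q, |diffLp P f q| ∂(P.prod P) + ⟪hw.toLp, f⟫ with hΦ
  have hΦtoLp : ∀ (Y : Ω → ℝ) (hY : MemLp Y 2 P), Φ hY.toLp = pairEnergy P w Y := by
    intro Y hY
    simp only [hΦ]
    rw [← pairEnergy_Lp]
    exact pairEnergy_congr hY.coeFn_toLp hw.coeFn_toLp
  have hΦcont : Continuous Φ := by
    have := (continuous_integral_abs_Lp (P := P.prod P)).comp (diffLp P).continuous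
    exact (this.const_mul _).add (by fun_prop)
  have hΦconv : ConvexOn ℝ K Φ := by
    have h1 := (convexOn_integral_abs_Lp (P := P.prod P)).comp_linearMap
      (diffLp P : Lp ℝ 2 P →ₗ[ℝ] Lp ℝ 2 (P.prod P))
    have h2 : ConvexOn ℝ univ fun f : Lp ℝ 2 P => ⟪hw.toLp, f⟫ :=
      ((innerSL ℝ hw.toLp : Lp ℝ 2 P →L[ℝ] ℝ) : Lp ℝ 2 P →ₗ[ℝ] ℝ).convexOn convex_univ
    exact ((h1.smul (by norm_num : (0 : ℝ) ≤ 1 / 4)).add h2).subset (subset_univ _) hconv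
  have hΦbdd : ∀ f ∈ K, -(‖hw.toLp‖ * R) ≤ Φ f := by
    intro f hf
    have h1 : 0 ≤ ∫ q, |diffLp P f q| ∂(P.prod P) := integral_nonneg fun q => abs_nonneg _
    have h2 : ‖f‖ ≤ R := by
      have := Lp.norm_le_of_ae_bound (f := f) hR (((memK f).1 hf).mono fun p hp => abs_le.2 hp)
      simpa [measureUnivNNReal] using this
    have h3 := neg_le_of_abs_le (abs_real_inner_le_norm hw.toLp f)
    have h4 := mul_le_mul_of_nonneg_left h2 (norm_nonneg hw.toLp)
    simp only [hΦ]; linarith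
  have hne : K.Nonempty := ⟨_, htoLp (fun _ => 0) (hmemLp _ measurable_const
    fun _ => ⟨by linarith, hR⟩) fun _ => ⟨by linarith, hR⟩⟩
  obtain ⟨f, hfK, hf⟩ := exists_minimizer_sq_dist_add isClosed_Icc hne hΦconv hΦcont hΦbdd hc
    hX₀.toLp
  have hfm : Measurable f := (Lp.stronglyMeasurable f).measurable
  have hXmem : ∀ p, max (-R) (min R (f p)) ∈ Icc (-R) R := fun p =>
    ⟨le_max_left _ _, max_le (by linarith) (min_le_left _ _)⟩
  have hXm : Measurable fun p => max (-R) (min R (f p)) :=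
    measurable_const.max (measurable_const.min hfm)
  refine ⟨_, hXm, hXmem, fun Y hY hYR => ?_⟩
  have hfX : f = (hmemLp _ hXm hXmem).toLp := by
    refine Lp.ext ?_
    filter_upwards [(memK f).1 hfK, (hmemLp _ hXm hXmem).coeFn_toLp] with p h1 h2
    rw [h2, min_eq_right h1.2, max_eq_right h1.1]
  have := hf _ (htoLp Y (hmemLp Y hY hYR) hYR)
  rw [sq_norm_sub_toLp, hΦtoLp] at this
  refine le_trans (le_of_eq ?_) this
  rw [← sq_norm_sub_toLp (hmemLp _ hXm hXmem) hX₀, ← hΦtoLp _ (hmemLp _ hXm hXmem), ← hfX]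

end Lp

section Quantile

lemma lintegral_mul_le_of_forall_Iic_prod_le {γ γ' : Measure (ℝ × ℝ)} [SFinite γ] [SFinite γ']
    (hle : ∀ s t : ℝ, γ (Iic s ×ˢ Iic t) ≤ γ' (Iic s ×ˢ Iic t)) (R : ℝ) :
    ∫⁻ p, ENNReal.ofReal (R - p.1) * ENNReal.ofReal (R - p.2) ∂γ
      ≤ ∫⁻ p, ENNReal.ofReal (R - p.1) * ENNReal.ofReal (R - p.2) ∂γ' := by
  set l : Measure (ℝ × ℝ) :=
    (volume.restrict (Iic R)).prod (volume.restrict (Iic R)) with hl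
  set B : Set ((ℝ × ℝ) × (ℝ × ℝ)) := {z | z.1 ≤ z.2} with hB
  have hBm : MeasurableSet B := by
    have : IsClosed B := isClosed_le continuous_fst continuous_snd
    exact this.measurableSet
  have hsec : ∀ p : ℝ × ℝ,
      l (Prod.mk p ⁻¹' B) = ENNReal.ofReal (R - p.1) * ENNReal.ofReal (R - p.2) := by
    intro p
    have e : Prod.mk p ⁻¹' B = Ici p.1 ×ˢ Ici p.2 := by
      rw [← Ici_prod_eq]; rfl
    rw [e, hl, Measure.prod_prod, Measure.restrict_apply measurableSet_Ici,
      Measure.restrict_apply measurableSet_Ici, Ici_inter_Iic, Ici_inter_Iic,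
      Real.volume_Icc, Real.volume_Icc]
  have hsec' : ∀ q : ℝ × ℝ, (fun p => (p, q)) ⁻¹' B = Iic q.1 ×ˢ Iic q.2 := by
    intro q
    rw [← Iic_prod_eq]; rfl
  simp_rw [← hsec]
  rw [← Measure.prod_apply hBm, ← Measure.prod_apply hBm, Measure.prod_apply_symm hBm,
    Measure.prod_apply_symm hBm]
  refine lintegral_mono fun q => ?_
  rw [hsec']
  exact hle _ _

lemma integral_sq_sub_le_of_forall_Iic_prod_le {γ γ' : Measure (ℝ × ℝ)} [IsFiniteMeasure γ]
    [IsFiniteMeasure γ'] {R : ℝ}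
    (hfst : γ.map Prod.fst = γ'.map Prod.fst) (hsnd : γ.map Prod.snd = γ'.map Prod.snd)
    (h₁ : ∀ᵐ x ∂(γ'.map Prod.fst), x ∈ Icc (-R) R)
    (h₂ : ∀ᵐ x ∂(γ'.map Prod.snd), x ∈ Icc (-R) R)
    (hle : ∀ s t : ℝ, γ (Iic s ×ˢ Iic t) ≤ γ' (Iic s ×ˢ Iic t)) :
    ∫ p, (p.1 - p.2) ^ 2 ∂γ' ≤ ∫ p, (p.1 - p.2) ^ 2 ∂γ := by
  have main : ∀ (ρ : Measure (ℝ × ℝ)) [IsFiniteMeasure ρ],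
      ρ.map Prod.fst = γ'.map Prod.fst → ρ.map Prod.snd = γ'.map Prod.snd →
      Integrable (fun p : ℝ × ℝ => (R - p.1) * (R - p.2)) ρ ∧
      0 ≤ᵐ[ρ] (fun p : ℝ × ℝ => (R - p.1) * (R - p.2)) ∧
      (∀ᵐ p ∂ρ, ENNReal.ofReal ((R - p.1) * (R - p.2))
        = ENNReal.ofReal (R - p.1) * ENNReal.ofReal (R - p.2)) ∧
      ∫ p, (p.1 - p.2) ^ 2 ∂ρ = ∫ x, (R - x) ^ 2 ∂(γ'.map Prod.fst)
        + ∫ x, (R - x) ^ 2 ∂(γ'.map Prod.snd) - 2 * ∫ p, (R - p.1) * (R - p.2) ∂ρ := by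
    intro ρ _ hf hs
    have b1 : ∀ᵐ p ∂ρ, p.1 ∈ Icc (-R) R :=
      ae_of_ae_map measurable_fst.aemeasurable (hf ▸ h₁)
    have b2 : ∀ᵐ p ∂ρ, p.2 ∈ Icc (-R) R :=
      ae_of_ae_map measurable_snd.aemeasurable (hs ▸ h₂)
    have i12 : Integrable (fun p : ℝ × ℝ => (R - p.1) * (R - p.2)) ρ := by
      refine Integrable.of_bound (by fun_prop) ((2 * R) * (2 * R)) ?_
      filter_upwards [b1, b2] with p ⟨h1, h2⟩ ⟨h3, h4⟩
      rw [Real.norm_eq_abs, abs_of_nonneg (mul_nonneg (by linarith) (by linarith))]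
      exact mul_le_mul (by linarith) (by linarith) (by linarith) (by linarith)
    have i1 : Integrable (fun p : ℝ × ℝ => (R - p.1) ^ 2) ρ := by
      refine Integrable.of_bound (by fun_prop) ((2 * R) ^ 2) ?_
      filter_upwards [b1] with p ⟨h1, h2⟩
      rw [Real.norm_eq_abs, abs_of_nonneg (sq_nonneg _)]
      exact pow_le_pow_left₀ (by linarith) (by linarith) 2
    have i2 : Integrable (fun p : ℝ × ℝ => (R - p.2) ^ 2) ρ := by
      refine Integrable.of_bound (by fun_prop) ((2 * R) ^ 2) ?_
      filter_upwards [b2] with p ⟨h1, h2⟩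
      rw [Real.norm_eq_abs, abs_of_nonneg (sq_nonneg _)]
      exact pow_le_pow_left₀ (by linarith) (by linarith) 2
    refine ⟨i12, ?_, ?_, ?_⟩
    · filter_upwards [b1, b2] with p h1 h2
      exact mul_nonneg (by linarith [h1.2]) (by linarith [h2.2])
    · filter_upwards [b1] with p h1
      exact ENNReal.ofReal_mul (by linarith [h1.2])
    · have i3 : Integrable (fun p : ℝ × ℝ => (R - p.1) ^ 2 + (R - p.2) ^ 2) ρ := i1.add i2
      rw [← hf, ← hs, integral_map measurable_fst.aemeasurable (by fun_prop),
        integral_map measurable_snd.aemeasurable (by fun_prop), ← integral_const_mul,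
        ← integral_add i1 i2, ← integral_sub i3 (i12.const_mul 2)]
      refine integral_congr_ae (Eventually.of_forall fun p => ?_)
      ring
  obtain ⟨i, n, e, s⟩ := main γ hfst hsnd
  obtain ⟨i', n', e', s'⟩ := main γ' rfl rfl
  have hcross : ∫ p, (R - p.1) * (R - p.2) ∂γ ≤ ∫ p, (R - p.1) * (R - p.2) ∂γ' := by
    rw [integral_eq_lintegral_of_nonneg_ae n i.1, integral_eq_lintegral_of_nonneg_ae n' i'.1]
    refine ENNReal.toReal_mono ?_ ?_
    · have := i'.2
      rw [hasFiniteIntegral_iff_ofReal n'] at this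
      exact this.ne
    · rw [lintegral_congr_ae e, lintegral_congr_ae e']
      exact lintegral_mul_le_of_forall_Iic_prod_le hle R
  rw [s, s']
  linarith

/-- `f` is a quantile function on `(0, M)` of the measure `ν`. -/
def IsQuantile (ν : Measure ℝ) (M : ℝ) (f : ℝ → ℝ) : Prop :=
  ∀ m ∈ Ioo 0 M, ∀ x, f m ≤ x ↔ ENNReal.ofReal m ≤ ν (Iic x)

lemma volume_restrict_Ioo_setOf_ofReal_le {M : ℝ} {c : ℝ≥0∞} (hc : c ≤ ENNReal.ofReal M) :
    volume.restrict (Ioo 0 M) {m | ENNReal.ofReal m ≤ c} = c := by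
  have hm : MeasurableSet {m : ℝ | ENNReal.ofReal m ≤ c} :=
    measurableSet_le ENNReal.measurable_ofReal measurable_const
  have hctop : c ≠ ∞ := ne_top_of_le_ne_top ENNReal.ofReal_ne_top hc
  rw [Measure.restrict_apply hm]
  refine le_antisymm ?_ ?_
  · calc volume ({m | ENNReal.ofReal m ≤ c} ∩ Ioo 0 M) ≤ volume (Ioc 0 c.toReal) := by
          refine measure_mono fun m hm => ⟨hm.2.1, ?_⟩
          exact (ENNReal.ofReal_le_iff_le_toReal hctop).1 hm.1
      _ = c := by rw [Real.volume_Ioc, sub_zero, ENNReal.ofReal_toReal hctop]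
  · calc c = volume (Ioo 0 c.toReal) := by
          rw [Real.volume_Ioo, sub_zero, ENNReal.ofReal_toReal hctop]
      _ ≤ _ := by
          refine measure_mono fun m hm => ⟨?_, hm.1, ?_⟩
          · exact (ENNReal.ofReal_le_iff_le_toReal hctop).2 hm.2.le
          · by_contra! hMm
            have h1 : c.toReal ≤ max M 0 := by
              rw [← ENNReal.toReal_ofReal']
              exact ENNReal.toReal_mono ENNReal.ofReal_ne_top hc
            have h2 : max M 0 ≤ m := max_le hMm hm.1.le
            exact absurd hm.2 (not_lt.2 (h1.trans h2))

lemma IsQuantile.map_eq {ν : Measure ℝ} {M : ℝ} {f : ℝ → ℝ} (hq : IsQuantile ν M f)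
    (hf : Measurable f) (hM : ν univ = ENNReal.ofReal M) :
    (volume.restrict (Ioo 0 M)).map f = ν := by
  refine Measure.ext_of_Iic _ _ fun x => ?_
  rw [Measure.map_apply hf measurableSet_Iic,
    ← volume_restrict_Ioo_setOf_ofReal_le (M := M) (c := ν (Iic x))
      ((measure_mono (subset_univ _)).trans_eq hM)]
  refine measure_congr ?_
  filter_upwards [ae_restrict_mem measurableSet_Ioo] with m hm
  exact propext (hq m hm x)

lemma IsQuantile.W2sq_eq {ν θ : Measure ℝ} {M R : ℝ} {f g : ℝ → ℝ}
    (hqf : IsQuantile ν M f) (hqg : IsQuantile θ M g) (hf : Measurable f) (hg : Measurable g)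
    (hν : ν univ = ENNReal.ofReal M) (hθ : θ univ = ENNReal.ofReal M)
    (hνR : ν (Icc (-R) R)ᶜ = 0) (hθR : θ (Icc (-R) R)ᶜ = 0) :
    W2sq ν θ = ∫ m in Ioo 0 M, (f m - g m) ^ 2 := by
  have hfg : Measurable fun m => (f m, g m) := hf.prodMk hg
  have hfst : ((volume.restrict (Ioo 0 M)).map fun m => (f m, g m)).map Prod.fst = ν := by
    rw [Measure.map_map measurable_fst hfg]; exact hqf.map_eq hf hν
  have hsnd : ((volume.restrict (Ioo 0 M)).map fun m => (f m, g m)).map Prod.snd = θ := by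
    rw [Measure.map_map measurable_snd hfg]; exact hqg.map_eq hg hθ
  have hval : ∫ p : ℝ × ℝ, (p.1 - p.2) ^ 2 ∂((volume.restrict (Ioo 0 M)).map fun m => (f m, g m))
      = ∫ m in Ioo 0 M, (f m - g m) ^ 2 :=
    integral_map hfg.aemeasurable (by fun_prop)
  refine IsLeast.csInf_eq ⟨⟨_, hfst, hsnd, hval.symm⟩, ?_⟩
  rintro _ ⟨γ, h1, h2, rfl⟩
  have : IsFiniteMeasure γ := ⟨by
    have : γ univ = ν univ := by rw [← h1, Measure.map_apply measurable_fst .univ, preimage_univ]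
    rw [this, hν]; exact ENNReal.ofReal_lt_top⟩
  rw [← hval]
  refine integral_sq_sub_le_of_forall_Iic_prod_le (R := R) (h1.trans hfst.symm)
    (h2.trans hsnd.symm) (by rw [hfst]; exact hνR) (by rw [hsnd]; exact hθR) fun s t => ?_
  have hmin : volume.restrict (Ioo 0 M) ((fun m => (f m, g m)) ⁻¹' (Iic s ×ˢ Iic t))
      = min (ν (Iic s)) (θ (Iic t)) := by
    rw [← volume_restrict_Ioo_setOf_ofReal_le (M := M) (c := min (ν (Iic s)) (θ (Iic t)))
      ((min_le_left _ _).trans ((measure_mono (subset_univ _)).trans_eq hν))]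
    refine measure_congr ?_
    filter_upwards [ae_restrict_mem measurableSet_Ioo] with m hm
    exact propext (((hqf m hm s).and (hqg m hm t)).trans le_min_iff.symm)
  rw [Measure.map_apply hfg (measurableSet_Iic.prod measurableSet_Iic), hmin, ← h1, ← h2,
    Measure.map_apply measurable_fst measurableSet_Iic,
    Measure.map_apply measurable_snd measurableSet_Iic]
  exact le_min (measure_mono fun p hp => hp.1) (measure_mono fun p hp => hp.2)

lemma Iic_subset_compl_Icc {x y z : ℝ} (h : x < y) : Iic x ⊆ (Icc y z)ᶜ :=
  fun _ hw hw' => (hw'.1.trans hw).not_gt h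

lemma sInf_le_iff_ofReal_le_measure_Iic {ν : Measure ℝ} [IsFiniteMeasure ν] {R m x : ℝ}
    (hR : ν (Icc (-R) R)ᶜ = 0) (hm : 0 < m) (hmν : ENNReal.ofReal m ≤ ν univ) :
    sInf {x | ENNReal.ofReal m ≤ ν (Iic x)} ≤ x ↔ ENNReal.ofReal m ≤ ν (Iic x) := by
  set S := {x | ENNReal.ofReal m ≤ ν (Iic x)} with hS
  have hRS : R ∈ S := by
    have : ν (Iic R)ᶜ = 0 := measure_mono_null (compl_subset_compl.2 Icc_subset_Iic_self) hR
    rw [hS, mem_ofPred, measure_of_measure_compl_eq_zero this]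
    exact hmν
  have hbdd : BddBelow S := by
    refine ⟨-R, fun y hy => ?_⟩
    by_contra! hlt
    have : ν (Iic y) = 0 :=
      measure_mono_null (Iic_subset_compl_Icc hlt) hR
    rw [hS, mem_ofPred, this, nonpos_iff_eq_zero, ENNReal.ofReal_eq_zero] at hy
    linarith
  have hup : ∀ y ∈ S, ∀ z, y ≤ z → z ∈ S := fun y hy z hyz =>
    le_trans hy (measure_mono (Iic_subset_Iic.2 hyz))
  refine ⟨fun hx => ?_, fun hx => csInf_le hbdd hx⟩
  obtain ⟨u, hu, hux, hlim⟩ := exists_seq_strictAnti_tendsto x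
  have hInter : Iic x = ⋂ n, Iic (u n) := by
    ext z
    simp only [mem_Iic, mem_iInter]
    exact ⟨fun hz n => hz.trans (hux n).le, fun hz => ge_of_tendsto' hlim hz⟩
  rw [hInter]
  refine ge_of_tendsto' (tendsto_measure_iInter_atTop (fun n => measurableSet_Iic.nullMeasurableSet)
    (fun i j hij => Iic_subset_Iic.2 (hu.antitone hij)) ⟨0, measure_ne_top _ _⟩) fun n => ?_
  obtain ⟨y, hy, hyn⟩ := exists_lt_of_csInf_lt ⟨R, hRS⟩ (hx.trans_lt (hux n))
  exact hup y hy _ hyn.le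

/-- Jointly measurable quantile functions of a measurable family of measures on `[-R, R]`. -/
lemma exists_measurable_isQuantile {ν : ℝ → Measure ℝ}
    (hν : ∀ s : Set ℝ, MeasurableSet s → Measurable fun a => ν a s) {H : ℝ → ℝ}
    (hH : Measurable H) {R : ℝ} (hR : 0 ≤ R) :
    ∃ X : ℝ × ℝ → ℝ, Measurable X ∧ (∀ p, X p ∈ Icc (-R) R) ∧
      ∀ a, ν a univ = ENNReal.ofReal (H a) → ν a (Icc (-R) R)ᶜ = 0 →
        IsQuantile (ν a) (H a) fun m => X (a, m) := by
  classical
  set G : Set (ℝ × ℝ) := {p | (ν p.1 univ = ENNReal.ofReal (H p.1) ∧ ν p.1 (Icc (-R) R)ᶜ = 0) ∧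
    0 < p.2 ∧ p.2 < H p.1} with hG
  have hGm : MeasurableSet G := by
    refine .inter (.inter ?_ ?_) (.inter ?_ ?_)
    · exact measurableSet_eq_fun ((hν _ .univ).comp measurable_fst)
        (hH.comp measurable_fst).ennreal_ofReal
    · exact measurableSet_eq_fun ((hν _ measurableSet_Icc.compl).comp measurable_fst)
        measurable_const
    · exact measurableSet_lt measurable_const measurable_snd
    · exact measurableSet_lt measurable_snd (hH.comp measurable_fst)
  set X : ℝ × ℝ → ℝ := fun p =>
    if p ∈ G then sInf {x | ENNReal.ofReal p.2 ≤ ν p.1 (Iic x)} else 0 with hX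
  have hXG : ∀ p ∈ G, ∀ x, X p ≤ x ↔ ENNReal.ofReal p.2 ≤ ν p.1 (Iic x) := by
    intro p hp x
    have : IsFiniteMeasure (ν p.1) := ⟨by rw [hp.1.1]; exact ENNReal.ofReal_lt_top⟩
    simp only [hX, if_pos hp]
    exact sInf_le_iff_ofReal_le_measure_Iic hp.1.2 hp.2.1
      (by rw [hp.1.1]; exact ENNReal.ofReal_le_ofReal hp.2.2.le)
  have hX0 : ∀ p ∉ G, X p = 0 := fun p hp => if_neg hp
  refine ⟨X, measurable_of_Iic fun x => ?_, fun p => ?_, fun a h1 h2 m hm x => ?_⟩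
  · have e : X ⁻¹' Iic x = (G ∩ {p | ENNReal.ofReal p.2 ≤ ν p.1 (Iic x)}) ∪ (Gᶜ ∩ {_p | 0 ≤ x}) := by
      ext p
      by_cases hp : p ∈ G
      · simp [hp, hXG p hp x]
      · simp [hp, hX0 p hp]
    rw [e]
    refine .union (hGm.inter ?_) (hGm.compl.inter (.const _))
    exact measurableSet_le measurable_snd.ennreal_ofReal
      ((hν _ measurableSet_Iic).comp measurable_fst)
  · by_cases hp : p ∈ G
    · constructor
      · by_contra! hlt
        have h1 := (hXG p hp _).1 le_rfl
        have h2 : ν p.1 (Iic (X p)) = 0 := measure_mono_null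
          (Iic_subset_compl_Icc hlt) hp.1.2
        rw [h2, nonpos_iff_eq_zero, ENNReal.ofReal_eq_zero] at h1
        linarith [hp.2.1]
      · rw [hXG p hp, measure_of_measure_compl_eq_zero
          (measure_mono_null (compl_subset_compl.2 Icc_subset_Iic_self) hp.1.2), hp.1.1]
        exact ENNReal.ofReal_le_ofReal hp.2.2.le
    · rw [hX0 p hp]; exact ⟨by linarith, hR⟩
  · exact hXG (a, m) ⟨⟨h1, h2⟩, hm⟩ x

end Quantile

section Strip

/-- The product of `μ` and Lebesgue measure, restricted to `{(a, m) | 0 < m < H a}`. -/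
noncomputable def stripMeasure (μ : Measure ℝ) (H : ℝ → ℝ) : Measure (ℝ × ℝ) :=
  (μ.prod volume).restrict {p | p.2 ∈ Ioo 0 (H p.1)}

variable {μ : Measure ℝ} {H : ℝ → ℝ}

lemma measurableSet_strip (hH : Measurable H) :
    MeasurableSet {p : ℝ × ℝ | p.2 ∈ Ioo 0 (H p.1)} :=
  (measurableSet_lt measurable_const measurable_snd).inter
    (measurableSet_lt measurable_snd (hH.comp measurable_fst))

lemma stripMeasure_apply (hH : Measurable H) {s : Set (ℝ × ℝ)}
    (hs : MeasurableSet s) :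
    stripMeasure μ H s = ∫⁻ a, volume.restrict (Ioo 0 (H a)) (Prod.mk a ⁻¹' s) ∂μ := by
  rw [stripMeasure, Measure.restrict_apply hs,
    Measure.prod_apply (hs.inter (measurableSet_strip hH))]
  refine lintegral_congr fun a => ?_
  rw [Measure.restrict_apply (measurable_prodMk_left hs)]
  rfl

lemma integrable_and_integral_stripMeasure [SFinite μ] (hH : Measurable H) {f : ℝ × ℝ → ℝ}
    (hf : Integrable f (stripMeasure μ H)) :
    Integrable (fun a => ∫ m in Ioo 0 (H a), f (a, m)) μ ∧
      ∫ p, f p ∂(stripMeasure μ H) = ∫ a, (∫ m in Ioo 0 (H a), f (a, m)) ∂μ := by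
  have hS := measurableSet_strip hH
  have hf' := (integrable_indicator_iff hS).2 hf
  have e : ∀ a, ∫ m, ({p : ℝ × ℝ | p.2 ∈ Ioo 0 (H p.1)}.indicator f) (a, m)
      = ∫ m in Ioo 0 (H a), f (a, m) := by
    intro a
    rw [← integral_indicator measurableSet_Ioo]
    rfl
  constructor
  · simpa only [e] using hf'.integral_prod_left
  · rw [stripMeasure, ← integral_indicator hS, integral_prod _ hf']
    simp_rw [e]

lemma ae_stripMeasure_fst [SFinite μ] {p : ℝ → Prop} (h : ∀ᵐ a ∂μ, p a) :
    ∀ᵐ q ∂(stripMeasure μ H), p q.1 :=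
  ae_restrict_of_ae (Measure.quasiMeasurePreserving_fst.ae h)

lemma nuOtimes_eq_map_stripMeasure (hH : Measurable H) {ν : ℝ → Measure ℝ}
    {X : ℝ × ℝ → ℝ} (hX : Measurable X)
    (hν : ∀ᵐ a ∂μ, ν a = (volume.restrict (Ioo 0 (H a))).map fun m => X (a, m)) :
    nuOtimes μ ν = (stripMeasure μ H).map fun p => (p.1, X p) := by
  have hT : Measurable fun p : ℝ × ℝ => (p.1, X p) := measurable_fst.prodMk hX
  have hsec : ∀ a, Measurable fun m => (a, X (a, m)) := fun a =>
    hT.comp measurable_prodMk_left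
  have hae : (fun a => (ν a).map fun x => (a, x))
      =ᵐ[μ] fun a => (volume.restrict (Ioo 0 (H a))).map fun m => (a, X (a, m)) := by
    filter_upwards [hν] with a ha
    rw [ha, Measure.map_map (g := Prod.mk a) (f := fun m => X (a, m)) measurable_prodMk_left
      (hX.comp measurable_prodMk_left)]
    rfl
  have happ : ∀ (s : Set (ℝ × ℝ)), MeasurableSet s → ∀ a,
      ((volume.restrict (Ioo 0 (H a))).map fun m => (a, X (a, m))) s
        = volume.restrict (Ioo 0 (H a)) (Prod.mk a ⁻¹' ((fun p => (p.1, X p)) ⁻¹' s)) :=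
    fun s hs a => Measure.map_apply (hsec a) hs
  have hmeas : Measurable fun a =>
      (volume.restrict (Ioo 0 (H a))).map fun m => (a, X (a, m)) := by
    refine Measure.measurable_of_measurable_coe _ fun s hs => ?_
    simp_rw [happ s hs, Measure.restrict_apply (measurable_prodMk_left (hT hs))]
    exact measurable_measure_prodMk_left ((hT hs).inter (measurableSet_strip hH))
  ext s hs
  rw [nuOtimes, Measure.bind_apply hs (hmeas.aemeasurable.congr hae.symm),
    Measure.map_apply hT hs, stripMeasure_apply hH (hT hs)]
  refine lintegral_congr_ae ?_
  filter_upwards [hae] with a ha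
  rw [ha, happ s hs]

lemma Jen_eq_pairEnergy [SFinite μ] (hH : Measurable H) {ν : ℝ → Measure ℝ}
    {X : ℝ × ℝ → ℝ} (hX : Measurable X)
    (hν : ∀ᵐ a ∂μ, ν a = (volume.restrict (Ioo 0 (H a))).map fun m => X (a, m)) :
    Jen μ ν = pairEnergy (stripMeasure μ H) (fun p => 1 / 2 - p.1) X := by
  have hT : Measurable fun p : ℝ × ℝ => (p.1, X p) := measurable_fst.prodMk hX
  have : SFinite (stripMeasure μ H) := by unfold stripMeasure; infer_instance
  rw [Jen, J0, J1, pairEnergy, nuOtimes_eq_map_stripMeasure hH hX hν,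
    Measure.map_prod_map _ _ hT hT,
    integral_map (hT.prodMap hT).aemeasurable (by fun_prop),
    integral_map hT.aemeasurable (by fun_prop)]
  rfl

end Strip

lemma W2sq_le_setIntegral {M : ℝ} {ν θ : Measure ℝ} {f g : ℝ → ℝ}
    (hf : Measurable f) (hg : Measurable g)
    (hν : ν = (volume.restrict (Ioo 0 M)).map f) (hθ : θ = (volume.restrict (Ioo 0 M)).map g) :
    W2sq ν θ ≤ ∫ m in Ioo 0 M, (f m - g m) ^ 2 := by
  have hfg : Measurable fun m => (f m, g m) := hf.prodMk hg
  refine csInf_le ⟨0, ?_⟩ ⟨(volume.restrict (Ioo 0 M)).map fun m => (f m, g m), ?_, ?_,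
    (integral_map (f := fun p : ℝ × ℝ => (p.1 - p.2) ^ 2) hfg.aemeasurable (by fun_prop)).symm⟩
  · rintro _ ⟨γ, -, -, rfl⟩
    exact integral_nonneg fun p => sq_nonneg _
  · rw [Measure.map_map measurable_fst hfg, hν]; rfl
  · rw [Measure.map_map measurable_snd hfg, hθ]; rfl

lemma W2sq_nonneg (ν θ : Measure ℝ) : 0 ≤ W2sq ν θ :=
  Real.sInf_nonneg (by rintro _ ⟨γ, -, -, rfl⟩; exact integral_nonneg fun p => sq_nonneg _)

lemma isXR_map_stripMeasure {μ : Measure ℝ} {h H : ℝ → ℝ} {R : ℝ} (hH : Measurable H)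
    (hHh : ∀ᵐ a ∂μ, H a = h a) {X : ℝ × ℝ → ℝ} (hX : Measurable X)
    (hXR : ∀ p, X p ∈ Icc (-R) R) :
    IsXR μ h R fun a => (volume.restrict (Ioo 0 (H a))).map fun m => X (a, m) := by
  have hsec : ∀ a, Measurable fun m => X (a, m) := fun a => hX.comp measurable_prodMk_left
  refine ⟨fun s hs => ?_, ?_, Eventually.of_forall fun a => ?_⟩
  · simp_rw [Measure.map_apply (hsec _) hs, Measure.restrict_apply ((hsec _) hs)]
    exact measurable_measure_prodMk_left ((hX hs).inter (measurableSet_strip hH))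
  · filter_upwards [hHh] with a ha
    rw [Measure.map_apply (hsec a) .univ, preimage_univ, Measure.restrict_apply_univ,
      Real.volume_Ioo, sub_zero, ha]
  · rw [Measure.map_apply (hsec a) measurableSet_Icc.compl]
    convert measure_empty (μ := volume.restrict (Ioo 0 (H a)))
    ext m
    simpa using hXR (a, m)

/-- **One step of the JKO scheme is well-posed**: for every time step `τ > 0` and every
`ν₀ ∈ X_R`, the functional `ν ↦ (1/(2τ))·d²(ν, ν₀) + J(ν)` attains its minimum over `X_R`. -/
theorem jko_step_has_minimizer (Rv R τ : ℝ) (hRv : 0 < Rv) (hR : 0 < R) (hτ : 0 < τ)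
    (μ : Measure ℝ) [SigmaFinite μ] (hA : μ ((Set.Icc (-Rv) (Rv + 1))ᶜ) = 0)
    (h : ℝ → ℝ) (hh0 : ∀ a, 0 ≤ h a) (hhint : Integrable h μ) (hh1 : (∫ a, h a ∂μ) = 1)
    (ν₀ : ℝ → Measure ℝ) (hν₀ : IsXR μ h R ν₀) :
    ∃ νstar : ℝ → Measure ℝ, IsXR μ h R νstar ∧
      ∀ ν : ℝ → Measure ℝ, IsXR μ h R ν →
        (1 / (2 * τ)) * dsq μ νstar ν₀ + Jen μ νstar
          ≤ (1 / (2 * τ)) * dsq μ ν ν₀ + Jen μ ν := by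
  set H : ℝ → ℝ := fun a => (ν₀ a univ).toReal with hHdef
  have hH : Measurable H := (hν₀.meas _ .univ).ennreal_toReal
  have hHh : ∀ᵐ a ∂μ, H a = h a := by
    filter_upwards [hν₀.mass] with a ha
    rw [hHdef]
    simp only
    rw [ha, ENNReal.toReal_ofReal (hh0 a)]
  set P := stripMeasure μ H with hP
  have hPprob : IsProbabilityMeasure P := ⟨by
    rw [hP, stripMeasure_apply hH .univ, ← ENNReal.ofReal_one, ← hh1,
      ofReal_integral_eq_lintegral_ofReal hhint (Eventually.of_forall hh0)]
    refine lintegral_congr_ae ?_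
    filter_upwards [hHh] with a ha
    simp [ha]⟩
  have hrep : ∀ ν : ℝ → Measure ℝ, IsXR μ h R ν →
      ∃ X : ℝ × ℝ → ℝ, Measurable X ∧ (∀ p, X p ∈ Icc (-R) R) ∧
        ∀ᵐ a ∂μ, IsQuantile (ν a) (H a) (fun m => X (a, m)) ∧
          ν a univ = ENNReal.ofReal (H a) ∧ ν a (Icc (-R) R)ᶜ = 0 := by
    intro ν hν
    obtain ⟨X, hX, hXR, hq⟩ := exists_measurable_isQuantile hν.meas hH hR.le
    refine ⟨X, hX, hXR, ?_⟩
    filter_upwards [hν.mass, hν.supp, hHh] with a h1 h2 h3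
    rw [← h3] at h1
    exact ⟨hq a h1 h2, h1, h2⟩
  have hsec : ∀ {X : ℝ × ℝ → ℝ}, Measurable X → ∀ a, Measurable fun m => X (a, m) :=
    fun hX a => hX.comp measurable_prodMk_left
  have hmemLp : ∀ {X : ℝ × ℝ → ℝ}, Measurable X → (∀ p, X p ∈ Icc (-R) R) → MemLp X 2 P :=
    fun hX hXR => MemLp.of_bound hX.aestronglyMeasurable R
      (Eventually.of_forall fun p => abs_le.2 (hXR p))
  have hw : MemLp (fun p : ℝ × ℝ => 1 / 2 - p.1) 2 P := by
    refine MemLp.of_bound (by fun_prop) (Rv + 1) ?_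
    have hA' : ∀ᵐ a ∂μ, a ∈ Icc (-Rv) (Rv + 1) := hA
    filter_upwards [ae_stripMeasure_fst (H := H) hA'] with p hp
    exact abs_le.2 ⟨by linarith [hp.2], by linarith [hp.1]⟩
  obtain ⟨X₀, hX₀, hX₀R, hq₀⟩ := hrep ν₀ hν₀
  have hint : ∀ {X : ℝ × ℝ → ℝ}, Measurable X → (∀ p, X p ∈ Icc (-R) R) →
      Integrable (fun p => (X p - X₀ p) ^ 2) P :=
    fun hX hXR => ((hmemLp hX hXR).sub (hmemLp hX₀ hX₀R)).integrable_sq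
  obtain ⟨X, hX, hXR, hmin⟩ := exists_minimizer_sq_sub_add_pairEnergy (P := P)
    (c := 1 / (2 * τ)) (by positivity) hR.le (hmemLp hX₀ hX₀R) hw
  refine ⟨_, isXR_map_stripMeasure hH hHh hX hXR, fun ν hν => ?_⟩
  obtain ⟨Y, hY, hYR, hqY⟩ := hrep ν hν
  have hJY : Jen μ ν = pairEnergy P (fun p => 1 / 2 - p.1) Y :=
    Jen_eq_pairEnergy hH hY <| hqY.mono fun a ha => (ha.1.map_eq (hsec hY a) ha.2.1).symm
  have hdY : dsq μ ν ν₀ = ∫ p, (Y p - X₀ p) ^ 2 ∂P := by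
    rw [(integrable_and_integral_stripMeasure hH (hint hY hYR)).2]
    refine integral_congr_ae ?_
    filter_upwards [hqY, hq₀] with a ha ha₀
    exact ha.1.W2sq_eq ha₀.1 (hsec hY a) (hsec hX₀ a) ha.2.1 ha₀.2.1 ha.2.2 ha₀.2.2
  have hdX : dsq μ (fun a => (volume.restrict (Ioo 0 (H a))).map fun m => X (a, m)) ν₀
      ≤ ∫ p, (X p - X₀ p) ^ 2 ∂P := by
    obtain ⟨hi, he⟩ := integrable_and_integral_stripMeasure hH (hint hX hXR)
    rw [he]
    refine integral_mono_of_nonneg (Eventually.of_forall fun a => W2sq_nonneg _ _) hi ?_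
    filter_upwards [hq₀] with a ha₀
    exact W2sq_le_setIntegral (hsec hX a) (hsec hX₀ a) rfl
      (ha₀.1.map_eq (hsec hX₀ a) ha₀.2.1).symm
  rw [hJY, hdY, Jen_eq_pairEnergy hH hX (Eventually.of_forall fun a => rfl)]
  refine le_trans ?_ (hmin Y hY hYR)
  gcongr
end

section
/- Every gradient flow of J is a measure solution of the granular media system: if t ↦ ν(t) on [0, T] is a gradient flow of J with velocity t ↦ v(t), then, setting ρ_t = ∫_A ν(t)^a dμ(a), G_t(x) = ρ_t((−∞, x]) and G_t⁻(x) = ρ_t((−∞, x)), one has v(t)^a(x) ∈ [a − G_t(x), a − G_t⁻(x)] for ν(t)⊗μ-a.e. (a, x), for a.e. t ∈ [0, T]; moreover ‖v(t)‖_{L^∞(ν(t)⊗μ)} ≤ R_v + 2 for a.e. t. -/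
open MeasureTheory Filter

open ProbabilityTheory Topology
open scoped ENNReal

/-- A measurable family of measures that is finite almost everywhere agrees almost everywhere with
an s-finite kernel. -/
lemma exists_isSFiniteKernel_ae_eq {α β : Type*} [MeasurableSpace α] [MeasurableSpace β]
    {μ : Measure α} {ν : α → Measure β}
    (hν : ∀ s : Set β, MeasurableSet s → Measurable fun a => ν a s)
    (hfin : ∀ᵐ a ∂μ, ν a Set.univ < ∞) :
    ∃ κ : Kernel α β, IsSFiniteKernel κ ∧ ∀ᵐ a ∂μ, κ a = ν a := by
  classical
  have hνm : Measurable ν := Measure.measurable_of_measurable_coe _ hν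
  have hS : ∀ n : ℕ, MeasurableSet {a | ν a Set.univ < n} := fun n =>
    measurableSet_lt (hν _ .univ) measurable_const
  let κn : ℕ → Kernel α β := fun n =>
    Kernel.piecewise ((hS (n + 1)).diff (hS n)) ⟨ν, hνm⟩ 0
  have hκn : ∀ n, IsFiniteKernel (κn n) := fun n => by
    refine ⟨(n + 1 : ℕ), ENNReal.natCast_lt_top _, fun a => ?_⟩
    simp only [κn, Kernel.piecewise_apply]
    split_ifs with ha
    · exact le_of_lt ha.1
    · simp
  have hsum : ∀ a, Kernel.sum κn a = if ν a Set.univ < ∞ then ν a else 0 := fun a => by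
    rw [Kernel.sum_apply]
    split_ifs with ha
    · have hex : ∃ n : ℕ, ν a Set.univ < n := ENNReal.exists_nat_gt ha.ne
      obtain ⟨m, hm⟩ : ∃ m, Nat.find hex = m + 1 := by
        refine Nat.exists_eq_succ_of_ne_zero fun h0 => ?_
        have := Nat.find_spec hex
        rw [h0] at this
        simp at this
      have hm1 : ν a Set.univ < (m + 1 : ℕ) := hm ▸ Nat.find_spec hex
      have hm0 : ¬ ν a Set.univ < m := Nat.find_min hex (by omega)
      ext s hs
      rw [Measure.sum_apply _ hs, tsum_eq_single m]
      · simp only [κn, Kernel.piecewise_apply]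
        rw [if_pos ⟨hm1, hm0⟩]
        rfl
      · intro n hn
        simp only [κn, Kernel.piecewise_apply]
        rw [if_neg]
        · simp
        rintro ⟨h1, h2⟩
        simp only [Set.mem_ofPred_eq, not_lt] at h1 h2 hm0
        have e1 : (n : ℝ≥0∞) < (m + 1 : ℕ) := h2.trans_lt hm1
        have e2 : (m : ℝ≥0∞) < (n + 1 : ℕ) := hm0.trans_lt h1
        rw [Nat.cast_lt] at e1 e2
        omega
    · ext s hs
      rw [Measure.sum_apply _ hs]
      simp only [Measure.coe_zero, Pi.zero_apply, ENNReal.tsum_eq_zero]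
      intro n
      simp only [κn, Kernel.piecewise_apply]
      rw [if_neg]
      · simp
      rintro ⟨h1, -⟩
      exact ha (lt_trans h1 (ENNReal.natCast_lt_top _))
  refine ⟨Kernel.sum κn, inferInstance, ?_⟩
  filter_upwards [hfin] with a ha
  rw [hsum, if_pos ha]

lemma nuOtimes_congr {μ : Measure ℝ} {ν ν' : ℝ → Measure ℝ} (hνν' : ∀ᵐ a ∂μ, ν a = ν' a) :
    nuOtimes μ ν = nuOtimes μ ν' := by
  refine Measure.bind_congr_right ?_
  filter_upwards [hνν'] with a ha
  rw [ha]

lemma nuOtimes_kernel (μ : Measure ℝ) [SFinite μ] (κ : Kernel ℝ ℝ) [IsSFiniteKernel κ] :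
    nuOtimes μ κ = μ ⊗ₘ κ := by
  have hm : Measurable fun a => (κ a).map fun x => (a, x) := by
    refine Measure.measurable_of_measurable_coe _ fun s hs => ?_
    simp_rw [Measure.map_apply measurable_prodMk_left hs]
    exact Kernel.measurable_kernel_prodMk_left hs
  ext s hs
  rw [nuOtimes, Measure.bind_apply hs hm.aemeasurable, Measure.compProd_apply hs]
  simp_rw [Measure.map_apply measurable_prodMk_left hs]

/-- The fibrewise image of a kernel under a measurable map depending on the base point. -/
noncomputable def fibreMap {γ : Type*} [MeasurableSpace γ] (κ : Kernel ℝ ℝ) [IsSFiniteKernel κ]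
    (f : ℝ × ℝ → γ) (hf : Measurable f) : Kernel ℝ γ where
  toFun a := (κ a).map fun x => f (a, x)
  measurable' := by
    refine Measure.measurable_of_measurable_coe _ fun s hs => ?_
    have hfa : ∀ a, Measurable fun x => f (a, x) := fun a => hf.comp measurable_prodMk_left
    simp_rw [Measure.map_apply (hfa _) hs]
    exact Kernel.measurable_kernel_prodMk_left (hf hs)

lemma fibreMap_apply {γ : Type*} [MeasurableSpace γ] (κ : Kernel ℝ ℝ) [IsSFiniteKernel κ]
    (f : ℝ × ℝ → γ) (hf : Measurable f) (a : ℝ) :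
    fibreMap κ f hf a = (κ a).map fun x => f (a, x) := rfl

lemma nuOtimes_fibreMap (μ : Measure ℝ) [SFinite μ] (κ : Kernel ℝ ℝ) [IsSFiniteKernel κ]
    (f : ℝ × ℝ → ℝ) (hf : Measurable f) :
    nuOtimes μ (fibreMap κ f hf) = (nuOtimes μ κ).map fun p => (p.1, f p) := by
  have hT : Measurable fun p : ℝ × ℝ => (p.1, f p) := measurable_fst.prodMk hf
  have hTa : ∀ a, Measurable fun x => (a, f (a, x)) := fun a => hT.comp measurable_prodMk_left
  have hmap : ∀ a, (fibreMap κ f hf a).map (fun x => (a, x)) =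
      (κ a).map fun x => (a, f (a, x)) := fun a => by
    have hfa : Measurable fun x => f (a, x) := hf.comp measurable_prodMk_left
    rw [fibreMap_apply, Measure.map_map measurable_prodMk_left hfa]
    rfl
  ext s hs
  have hm : Measurable fun a => (κ a).map fun x => (a, f (a, x)) := by
    refine Measure.measurable_of_measurable_coe _ fun s hs => ?_
    simp_rw [Measure.map_apply (hTa _) hs]
    exact Kernel.measurable_kernel_prodMk_left (hT hs)
  rw [nuOtimes_kernel μ κ, nuOtimes, funext hmap, Measure.bind_apply hs hm.aemeasurable,
    Measure.map_apply hT hs, Measure.compProd_apply (hT hs)]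
  simp_rw [Measure.map_apply (hTa _) hs]
  rfl

namespace IsXR

variable {μ : Measure ℝ} {h : ℝ → ℝ} {R : ℝ} {ν : ℝ → Measure ℝ}

lemma exists_kernel (hν : IsXR μ h R ν) :
    ∃ κ : Kernel ℝ ℝ, IsSFiniteKernel κ ∧ ∀ᵐ a ∂μ, κ a = ν a := by
  refine exists_isSFiniteKernel_ae_eq hν.meas ?_
  filter_upwards [hν.mass] with a ha
  simp [ha]

variable [SigmaFinite μ]

lemma isProbabilityMeasure (hν : IsXR μ h R ν) (hh0 : ∀ a, 0 ≤ h a) (hhint : Integrable h μ)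
    (hh1 : (∫ a, h a ∂μ) = 1) : IsProbabilityMeasure (nuOtimes μ ν) := by
  obtain ⟨κ, _, hκν⟩ := hν.exists_kernel
  constructor
  rw [← nuOtimes_congr hκν, nuOtimes_kernel, Measure.compProd_apply .univ]
  simp_rw [Set.preimage_univ]
  have : ∫⁻ a, κ a Set.univ ∂μ = ∫⁻ a, ENNReal.ofReal (h a) ∂μ := by
    refine lintegral_congr_ae ?_
    filter_upwards [hκν, hν.mass] with a h1 h2
    rw [h1, h2]
  rw [this, ← ofReal_integral_eq_lintegral_ofReal hhint (ae_of_all _ hh0), hh1, ENNReal.ofReal_one]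

lemma ae_mem_Icc (hν : IsXR μ h R ν) : ∀ᵐ p ∂(nuOtimes μ ν), p.2 ∈ Set.Icc (-R) R := by
  obtain ⟨κ, _, hκν⟩ := hν.exists_kernel
  rw [← nuOtimes_congr hκν, nuOtimes_kernel,
    Measure.ae_compProd_iff (measurable_snd measurableSet_Icc)]
  filter_upwards [hκν, hν.supp] with a h1 h2
  rw [h1]
  exact h2

lemma ae_fst (hν : IsXR μ h R ν) {s : Set ℝ} (hs : MeasurableSet s) (hA : μ sᶜ = 0) :
    ∀ᵐ p ∂(nuOtimes μ ν), p.1 ∈ s := by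
  obtain ⟨κ, _, hκν⟩ := hν.exists_kernel
  rw [← nuOtimes_congr hκν, nuOtimes_kernel]
  exact Measure.ae_compProd_of_ae_fst κ hs hA

end IsXR

/-- Testing the subdifferential inequality against a bounded displacement of the positions. -/
lemma InSubdiff.integral_mul_le {μ : Measure ℝ} [SigmaFinite μ] {h : ℝ → ℝ} {R : ℝ} (hR : 0 < R)
    {ν : ℝ → Measure ℝ} (hν : IsXR μ h R ν) {w : ℝ → ℝ → ℝ}
    (hw : Measurable fun p : ℝ × ℝ => w p.1 p.2) (hsub : InSubdiff μ h ν w)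
    {ξ : ℝ × ℝ → ℝ} (hξ : Measurable ξ) {C : ℝ} (hC : ∀ p, |ξ p| ≤ C) :
    ∫ p, w p.1 p.2 * ξ p ∂(nuOtimes μ ν) ≤
      ((1 / 4) * ∫ q, |(q.1.2 + ξ q.1) - (q.2.2 + ξ q.2)| ∂((nuOtimes μ ν).prod (nuOtimes μ ν))
        + ∫ p, (1 / 2 - p.1) * (p.2 + ξ p) ∂(nuOtimes μ ν)) - Jen μ ν := by
  obtain ⟨κ, _, hκν⟩ := hν.exists_kernel
  have hC0 : 0 ≤ C := (abs_nonneg _).trans (hC (0, 0))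
  have hf : Measurable fun p : ℝ × ℝ => p.2 + ξ p := measurable_snd.add hξ
  have hg : Measurable fun p : ℝ × ℝ => (p.2, p.2 + ξ p) := measurable_snd.prodMk hf
  have hT : Measurable fun p : ℝ × ℝ => (p.1, p.2 + ξ p) := measurable_fst.prodMk hf
  have hfa : ∀ a, Measurable fun x => x + ξ (a, x) := fun a => hf.comp measurable_prodMk_left
  have hga : ∀ a, Measurable fun x => (x, x + ξ (a, x)) := fun a => hg.comp measurable_prodMk_left
  have hP : nuOtimes μ κ = nuOtimes μ ν := nuOtimes_congr hκν
  have hθP := nuOtimes_fibreMap μ κ _ hf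
  rw [hP] at hθP
  have hθ : IsXR μ h (R + C) (fibreMap κ _ hf) := by
    refine ⟨fun s hs => Kernel.measurable_coe _ hs, ?_, ?_⟩
    · filter_upwards [hκν, hν.mass] with a h1 h2
      rw [fibreMap_apply, Measure.map_apply (hfa a) .univ, Set.preimage_univ, h1, h2]
    · filter_upwards [hκν, hν.supp] with a h1 h2
      rw [fibreMap_apply, Measure.map_apply (hfa a) measurableSet_Icc.compl, h1]
      refine measure_mono_null (fun x hx => ?_) h2
      contrapose! hx
      simp only [Set.mem_compl_iff, not_not, Set.mem_preimage, Set.mem_Icc] at hx ⊢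
      have := abs_le.1 (hC (a, x))
      constructor <;> linarith
  have hγ : IsPlanFamily μ ν (fibreMap κ _ hf) (fibreMap κ _ hg) := by
    refine ⟨fun s hs => Kernel.measurable_coe _ hs, ?_, ae_of_all _ fun a => ?_⟩
    · filter_upwards [hκν] with a h1
      rw [fibreMap_apply, Measure.map_map measurable_fst (hga a), ← h1]
      exact Measure.map_id
    · rw [fibreMap_apply, Measure.map_map measurable_snd (hga a)]
      rfl
  have key := hsub.2 (R + C) (by linarith) _ hθ _ hγ
  have hrhs : ∫ a, (∫ p : ℝ × ℝ, w a p.1 * (p.2 - p.1) ∂(fibreMap κ _ hg a)) ∂μ =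
      ∫ p, w p.1 p.2 * ξ p ∂(nuOtimes μ ν) := by
    have hint : Integrable (fun p => w p.1 p.2 * ξ p) (nuOtimes μ ν) :=
      hsub.1.mul_bdd hξ.aestronglyMeasurable (ae_of_all _ hC)
    rw [← hP, nuOtimes_kernel] at hint ⊢
    rw [Measure.integral_compProd hint]
    refine integral_congr_ae (ae_of_all _ fun a => ?_)
    dsimp only
    have hwa : Measurable (w a) := hw.comp measurable_prodMk_left
    rw [fibreMap_apply, integral_map (hga a).aemeasurable]
    · simp
    · exact ((hwa.comp measurable_fst).mul
        (measurable_snd.sub measurable_fst)).aestronglyMeasurable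
  rw [hrhs] at key
  have hJ0 : J0 μ (fibreMap κ _ hf) =
      ∫ q, |(q.1.2 + ξ q.1) - (q.2.2 + ξ q.2)| ∂((nuOtimes μ ν).prod (nuOtimes μ ν)) := by
    have : SFinite (nuOtimes μ ν) := by rw [← hP, nuOtimes_kernel]; infer_instance
    rw [J0, hθP, Measure.map_prod_map _ _ hT hT, integral_map (hT.prodMap hT).aemeasurable]
    · rfl
    · exact Measurable.aestronglyMeasurable (by fun_prop)
  have hJ1 : J1 μ (fibreMap κ _ hf) = ∫ p, (1 / 2 - p.1) * (p.2 + ξ p) ∂(nuOtimes μ ν) := by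
    rw [J1, hθP, integral_map hT.aemeasurable]
    exact Measurable.aestronglyMeasurable (by fun_prop)
  rw [Jen, hJ0, hJ1] at key
  exact key

/-- The sign of the first-order change of `|x - y|` when `x` is displaced by `e`, biased upwards
for those `y` that lie within reach of the displacement. -/
noncomputable def stepSign (e x y : ℝ) : ℝ := if e * (y - x) < e ^ 2 then 1 else -1

lemma abs_stepSign (e x y : ℝ) : |stepSign e x y| = 1 := by
  unfold stepSign
  split_ifs <;> simp

lemma abs_add_sub_le (e x y : ℝ) : |x + e - y| ≤ |x - y| + |e| * stepSign e x y := by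
  unfold stepSign
  split_ifs with hlt
  · have := abs_add_le (x - y) e
    rw [show x + e - y = x - y + e by ring]
    linarith
  · rw [not_lt] at hlt
    rcases lt_trichotomy e 0 with he | rfl | he
    · have : y - x ≤ e := by nlinarith
      rw [abs_of_neg he, abs_of_nonneg (by linarith), abs_of_nonneg (by linarith)]
      linarith
    · simp
    · have : e ≤ y - x := by nlinarith
      rw [abs_of_pos he, abs_of_nonpos (by linarith), abs_of_nonpos (by linarith)]
      linarith

lemma stepSign_add_stepSign_nonneg {e : ℝ} (he : e ≠ 0) (x y : ℝ) :
    0 ≤ stepSign e x y + stepSign e y x := by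
  unfold stepSign
  have : 0 < e ^ 2 := by positivity
  split_ifs with h1 h2 h2
  · norm_num
  · norm_num
  · norm_num
  · have := mul_sub e y x
    have := mul_sub e x y
    linarith

lemma measurable_stepSign (e : ℝ) : Measurable fun p : ℝ × ℝ => stepSign e p.1 p.2 := by
  unfold stepSign
  exact Measurable.ite (measurableSet_lt (by fun_prop) measurable_const)
    measurable_const measurable_const

/-- Displacing the points of `E` by `e` changes `|x - y|` at most by the sum of the signed
contributions of its displaced end points. -/
lemma abs_add_indicator_sub_le {e : ℝ} (he : e ≠ 0) (E : Set (ℝ × ℝ)) (p q : ℝ × ℝ) :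
    |(p.2 + E.indicator (fun _ => e) p) - (q.2 + E.indicator (fun _ => e) q)| ≤
      |p.2 - q.2| + |e| * (E.indicator (fun p => stepSign e p.2 q.2) p
        + E.indicator (fun q => stepSign e q.2 p.2) q) := by
  classical
  have h1 := abs_add_sub_le e p.2 q.2
  have h2 := abs_add_sub_le e q.2 p.2
  have h3 := mul_nonneg (abs_nonneg e) (stepSign_add_stepSign_nonneg he p.2 q.2)
  by_cases hp : p ∈ E <;> by_cases hq : q ∈ E <;>
    simp only [hp, hq, Set.indicator_of_mem, Set.indicator_of_notMem, not_false_eq_true,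
      add_zero, zero_add, mul_zero, le_refl]
  · rw [add_sub_add_right_eq_sub]
    linarith
  · exact h1
  · rw [abs_sub_comm, abs_sub_comm p.2]
    exact h2

/-- A subgradient is dominated, in direction `e`, by the difference quotient of `J` of step `e`. -/
lemma InSubdiff.ae_mul_le {μ : Measure ℝ} [SigmaFinite μ] {h : ℝ → ℝ} {R Rv : ℝ} (hR : 0 < R)
    {ν : ℝ → Measure ℝ} (hν : IsXR μ h R ν) [IsProbabilityMeasure (nuOtimes μ ν)]
    (hA : μ ((Set.Icc (-Rv) (Rv + 1))ᶜ) = 0) {w : ℝ → ℝ → ℝ}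
    (hw : Measurable fun p : ℝ × ℝ => w p.1 p.2) (hsub : InSubdiff μ h ν w)
    {e : ℝ} (he : e ≠ 0) :
    ∀ᵐ p ∂(nuOtimes μ ν), e * w p.1 p.2 ≤
      |e| / 2 * (∫ q, stepSign e p.2 q.2 ∂(nuOtimes μ ν)) + e * (1 / 2 - p.1) := by
  set P := nuOtimes μ ν with hP
  have hfst : ∀ᵐ p ∂P, p.1 ∈ Set.Icc (-Rv) (Rv + 1) := hν.ae_fst measurableSet_Icc hA
  have hsnd : ∀ᵐ p ∂P, p.2 ∈ Set.Icc (-R) R := hν.ae_mem_Icc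
  have hi1 : Integrable (fun p : ℝ × ℝ => p.1) P :=
    Integrable.of_mem_Icc _ _ measurable_fst.aemeasurable hfst
  have hi2 : Integrable (fun p : ℝ × ℝ => p.2) P :=
    Integrable.of_mem_Icc _ _ measurable_snd.aemeasurable hsnd
  have hi12 : Integrable (fun p : ℝ × ℝ => (1 / 2 - p.1) * p.2) P := by
    refine ((integrable_const (1 / 2 : ℝ)).sub hi1).mul_bdd
      measurable_snd.aestronglyMeasurable (c := R) ?_
    filter_upwards [hsnd] with p hp using abs_le.2 hp
  let k : (ℝ × ℝ) × (ℝ × ℝ) → ℝ := fun q => stepSign e q.1.2 q.2.2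
  have hkm : Measurable k :=
    (measurable_stepSign e).comp ((measurable_snd.comp measurable_fst).prodMk
      (measurable_snd.comp measurable_snd))
  have hki : Integrable k (P.prod P) :=
    Integrable.of_bound hkm.aestronglyMeasurable 1 (ae_of_all _ fun q => (abs_stepSign _ _ _).le)
  have hKi : Integrable (fun p : ℝ × ℝ => ∫ q, stepSign e p.2 q.2 ∂P) P := hki.integral_prod_left
  have hai : Integrable (fun p : ℝ × ℝ => e * (1 / 2 - p.1)) P :=
    ((integrable_const _).sub hi1).const_mul _
  have hΦi : Integrable (fun p : ℝ × ℝ =>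
      |e| / 2 * (∫ q, stepSign e p.2 q.2 ∂P) + e * (1 / 2 - p.1)) P :=
    (hKi.const_mul _).add hai
  refine ae_le_of_forall_setIntegral_le (hsub.1.const_mul e) hΦi fun E hE _ => ?_
  have hξ : Measurable (E.indicator fun _ : ℝ × ℝ => e) := measurable_const.indicator hE
  have hξb : ∀ p, |E.indicator (fun _ : ℝ × ℝ => e) p| ≤ |e| := fun p => by
    by_cases hp : p ∈ E <;> simp [hp]
  have hξi : Integrable (E.indicator fun _ : ℝ × ℝ => e) P := (integrable_const e).indicator hE
  have key := hsub.integral_mul_le hR hν hw hξ hξb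
  rw [← hP] at key
  have hlhs : ∫ p, w p.1 p.2 * E.indicator (fun _ => e) p ∂P = ∫ p in E, e * w p.1 p.2 ∂P := by
    rw [← integral_indicator hE]
    refine integral_congr_ae (ae_of_all _ fun p => ?_)
    by_cases hp : p ∈ E <;> simp [hp, mul_comm]
  have hpot : ∫ p, (1 / 2 - p.1) * (p.2 + E.indicator (fun _ => e) p) ∂P =
      J1 μ ν + ∫ p in E, e * (1 / 2 - p.1) ∂P := by
    rw [J1, ← hP, ← integral_indicator hE, ← integral_add hi12 (hai.indicator hE)]
    refine integral_congr_ae (ae_of_all _ fun p => ?_)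
    by_cases hp : p ∈ E
    · simp [hp]
      ring
    · simp [hp]
  let k₁ : (ℝ × ℝ) × (ℝ × ℝ) → ℝ := fun q => E.indicator (fun p => stepSign e p.2 q.2.2) q.1
  let k₂ : (ℝ × ℝ) × (ℝ × ℝ) → ℝ := fun q => E.indicator (fun p => stepSign e p.2 q.1.2) q.2
  have hk₁ : k₁ = (E ×ˢ Set.univ).indicator k := by
    funext q
    by_cases hq : q.1 ∈ E <;> simp [k₁, k, Set.indicator, hq]
  have hk₁i : Integrable k₁ (P.prod P) := hk₁ ▸ hki.indicator (hE.prod .univ)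
  have hk₂i : Integrable k₂ (P.prod P) := hk₁i.swap
  have hk₁v : ∫ q, k₁ q ∂(P.prod P) = ∫ p in E, ∫ q, stepSign e p.2 q.2 ∂P ∂P := by
    rw [integral_prod _ hk₁i, ← integral_indicator hE]
    refine integral_congr_ae (ae_of_all _ fun p => ?_)
    by_cases hp : p ∈ E <;> simp [k₁, hp]
  have hk₂v : ∫ q, k₂ q ∂(P.prod P) = ∫ q, k₁ q ∂(P.prod P) := integral_prod_swap k₁
  have habs : Integrable (fun q : (ℝ × ℝ) × (ℝ × ℝ) => |q.1.2 - q.2.2|) (P.prod P) :=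
    ((hi2.comp_fst P).sub (hi2.comp_snd P)).abs
  have hks : Integrable (fun q => |e| * (k₁ q + k₂ q)) (P.prod P) := (hk₁i.add hk₂i).const_mul _
  have hint : ∫ q, |(q.1.2 + E.indicator (fun _ => e) q.1) - (q.2.2 + E.indicator (fun _ => e) q.2)|
      ∂(P.prod P) ≤ J0 μ ν + 2 * |e| * ∫ p in E, ∫ q, stepSign e p.2 q.2 ∂P ∂P := by
    calc _ ≤ ∫ q, (|q.1.2 - q.2.2| + |e| * (k₁ q + k₂ q)) ∂(P.prod P) := by
          refine integral_mono ?_ (habs.add hks)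
            fun q => abs_add_indicator_sub_le he E q.1 q.2
          exact (((hi2.add hξi).comp_fst P).sub ((hi2.add hξi).comp_snd P)).abs
      _ = _ := by
          rw [integral_add habs hks, integral_const_mul,
            integral_add hk₁i hk₂i, hk₂v, hk₁v, J0, ← hP]
          ring
  rw [integral_add (hKi.const_mul _).integrableOn
    hai.integrableOn, integral_const_mul (|e| / 2)]
  rw [hlhs, hpot, Jen] at key
  linarith

lemma Gcdf_eq_integral {μ : Measure ℝ} {ν : ℝ → Measure ℝ} (x : ℝ) :
    Gcdf μ ν x = ∫ q, (Set.Iic x).indicator (fun _ => (1 : ℝ)) q.2 ∂(nuOtimes μ ν) := by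
  have hm : MeasurableSet (Prod.snd ⁻¹' Set.Iic x : Set (ℝ × ℝ)) := measurable_snd measurableSet_Iic
  have : (fun q : ℝ × ℝ => (Set.Iic x).indicator (fun _ => (1 : ℝ)) q.2) =
      (Prod.snd ⁻¹' Set.Iic x : Set (ℝ × ℝ)).indicator 1 := by
    funext q
    simp [Set.indicator]
  rw [this, integral_indicator_one hm, Gcdf, barNu,
    Measure.map_apply measurable_snd measurableSet_Iic]
  rfl

lemma integral_stepSign_le {μ : Measure ℝ} {ν : ℝ → Measure ℝ}
    [IsProbabilityMeasure (nuOtimes μ ν)] {δ : ℝ} (hδ : 0 < δ) (x : ℝ) :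
    ∫ q, stepSign δ x q.2 ∂(nuOtimes μ ν) ≤ 2 * Gcdf μ ν (x + δ) - 1 ∧
    ∫ q, stepSign (-δ) x q.2 ∂(nuOtimes μ ν) ≤ 1 - 2 * Gcdf μ ν (x - δ) := by
  have hind : ∀ y : ℝ, Integrable (fun q : ℝ × ℝ => (Set.Iic y).indicator (fun _ => (1 : ℝ)) q.2)
      (nuOtimes μ ν) := fun y => by
    refine Integrable.of_bound
      ((measurable_const.indicator measurableSet_Iic).comp measurable_snd).aestronglyMeasurable 1
      (ae_of_all _ fun q => ?_)
    by_cases hq : q.2 ≤ y <;> simp [Set.indicator, hq]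
  have hstep : ∀ e : ℝ, Integrable (fun q : ℝ × ℝ => stepSign e x q.2) (nuOtimes μ ν) := fun e =>
    Integrable.of_bound
      ((measurable_stepSign e).comp (measurable_const.prodMk measurable_snd)).aestronglyMeasurable 1
      (ae_of_all _ fun q => (abs_stepSign _ _ _).le)
  have hc : ∫ _, (1 : ℝ) ∂(nuOtimes μ ν) = 1 := by simp
  constructor
  · rw [show 2 * Gcdf μ ν (x + δ) - 1 =
        2 * Gcdf μ ν (x + δ) - ∫ _, (1 : ℝ) ∂(nuOtimes μ ν) by rw [hc],
      Gcdf_eq_integral, ← integral_const_mul,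
      ← integral_sub ((hind _).const_mul _) (integrable_const _)]
    refine integral_mono (hstep _) (((hind _).const_mul _).sub (integrable_const _)) fun q => ?_
    by_cases hq : q.2 ≤ x + δ
    · simp only [stepSign, Set.indicator, Set.mem_Iic, hq, if_true]
      split_ifs <;> norm_num
    · have : ¬ δ * (q.2 - x) < δ ^ 2 := by nlinarith
      simp [stepSign, Set.indicator, hq, this]
  · rw [show 1 - 2 * Gcdf μ ν (x - δ) =
        (∫ _, (1 : ℝ) ∂(nuOtimes μ ν)) - 2 * Gcdf μ ν (x - δ) by rw [hc],
      Gcdf_eq_integral, ← integral_const_mul,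
      ← integral_sub (integrable_const _) ((hind _).const_mul _)]
    refine integral_mono (hstep _) ((integrable_const _).sub ((hind _).const_mul _)) fun q => ?_
    by_cases hq : q.2 ≤ x - δ
    · have : ¬ (-δ) * (q.2 - x) < (-δ) ^ 2 := by nlinarith
      simp only [stepSign, Set.indicator, Set.mem_Iic, hq, this, if_true, if_false]
      norm_num
    · simp only [stepSign, Set.indicator, Set.mem_Iic, hq, if_false]
      split_ifs <;> norm_num

section Cdf

variable {μ : Measure ℝ} {ν : ℝ → Measure ℝ} [IsProbabilityMeasure (nuOtimes μ ν)]

instance : IsProbabilityMeasure (barNu μ ν) :=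
  Measure.isProbabilityMeasure_map measurable_snd.aemeasurable

lemma tendsto_Gcdf_add (x : ℝ) :
    Tendsto (fun n : ℕ => Gcdf μ ν (x + 1 / ((n : ℝ) + 1))) atTop (𝓝 (Gcdf μ ν x)) := by
  have hanti : Antitone fun n : ℕ => Set.Iic (x + 1 / ((n : ℝ) + 1)) := fun m n hmn =>
    Set.Iic_subset_Iic.2 (by gcongr)
  have := tendsto_measure_iInter_atTop (μ := barNu μ ν)
    (fun n => measurableSet_Iic.nullMeasurableSet) hanti ⟨0, measure_ne_top _ _⟩
  have hI : ⋂ n : ℕ, Set.Iic (x + 1 / ((n : ℝ) + 1)) = Set.Iic x := by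
    refine Set.Subset.antisymm (fun y hy => ?_) (Set.subset_iInter fun n =>
      Set.Iic_subset_Iic.2 (le_add_of_nonneg_right (by positivity)))
    rw [Set.mem_iInter] at hy
    have hl := tendsto_one_div_add_atTop_nhds_zero_nat (𝕜 := ℝ).const_add x
    rw [add_zero] at hl
    exact ge_of_tendsto' hl hy
  rw [hI] at this
  exact (ENNReal.tendsto_toReal (measure_ne_top _ _)).comp this

lemma tendsto_Gcdf_sub (x : ℝ) :
    Tendsto (fun n : ℕ => Gcdf μ ν (x - 1 / ((n : ℝ) + 1))) atTop (𝓝 (GcdfM μ ν x)) := by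
  have hmono : Monotone fun n : ℕ => Set.Iic (x - 1 / ((n : ℝ) + 1)) := fun m n hmn =>
    Set.Iic_subset_Iic.2 (by gcongr)
  have := tendsto_measure_iUnion_atTop (μ := barNu μ ν) hmono
  have hU : ⋃ n : ℕ, Set.Iic (x - 1 / ((n : ℝ) + 1)) = Set.Iio x := by
    refine Set.Subset.antisymm (Set.iUnion_subset fun n y hy => ?_) fun y hy => ?_
    · have : 0 < 1 / ((n : ℝ) + 1) := by positivity
      simp only [Set.mem_Iic, Set.mem_Iio] at hy ⊢
      linarith
    · obtain ⟨n, hn⟩ := exists_nat_one_div_lt (sub_pos.2 (Set.mem_Iio.1 hy))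
      exact Set.mem_iUnion.2 ⟨n, by simp only [Set.mem_Iic]; linarith⟩
  rw [hU] at this
  exact (ENNReal.tendsto_toReal (measure_ne_top _ _)).comp this

end Cdf

/-- A measurable subgradient lies between the one-sided slopes of `J`. -/
lemma InSubdiff.ae_mem_Icc {μ : Measure ℝ} [SigmaFinite μ] {h : ℝ → ℝ} {R Rv : ℝ} (hR : 0 < R)
    {ν : ℝ → Measure ℝ} (hν : IsXR μ h R ν) [IsProbabilityMeasure (nuOtimes μ ν)]
    (hA : μ ((Set.Icc (-Rv) (Rv + 1))ᶜ) = 0) {w : ℝ → ℝ → ℝ}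
    (hw : Measurable fun p : ℝ × ℝ => w p.1 p.2) (hsub : InSubdiff μ h ν w) :
    ∀ᵐ p ∂(nuOtimes μ ν), w p.1 p.2 ∈ Set.Icc (GcdfM μ ν p.2 - p.1) (Gcdf μ ν p.2 - p.1) := by
  have hup : ∀ᵐ p ∂(nuOtimes μ ν), ∀ n : ℕ,
      w p.1 p.2 ≤ Gcdf μ ν (p.2 + 1 / ((n : ℝ) + 1)) - p.1 := by
    refine ae_all_iff.2 fun n => ?_
    have hδ : 0 < 1 / ((n : ℝ) + 1) := by positivity
    filter_upwards [hsub.ae_mul_le hR hν hA hw hδ.ne'] with p hp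
    generalize 1 / ((n : ℝ) + 1) = δ at hp hδ
    rw [abs_of_pos hδ] at hp
    have := (integral_stepSign_le (μ := μ) (ν := ν) hδ p.2).1
    nlinarith
  have hlow : ∀ᵐ p ∂(nuOtimes μ ν), ∀ n : ℕ,
      Gcdf μ ν (p.2 - 1 / ((n : ℝ) + 1)) - p.1 ≤ w p.1 p.2 := by
    refine ae_all_iff.2 fun n => ?_
    have hδ : 0 < 1 / ((n : ℝ) + 1) := by positivity
    filter_upwards [hsub.ae_mul_le hR hν hA hw (neg_ne_zero.2 hδ.ne')] with p hp
    generalize 1 / ((n : ℝ) + 1) = δ at hp hδ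
    rw [abs_neg, abs_of_pos hδ] at hp
    have := (integral_stepSign_le (μ := μ) (ν := ν) hδ p.2).2
    nlinarith
  filter_upwards [hup, hlow] with p h1 h2
  exact ⟨le_of_tendsto' ((tendsto_Gcdf_sub p.2).sub_const _) h2,
    ge_of_tendsto' ((tendsto_Gcdf_add p.2).sub_const _) h1⟩

/-- **Gradient flows are measure solutions of the granular media system**: if `t ↦ ν(t)` is a
gradient flow of `J` with velocity `t ↦ v(t)`, then, with `ρ_t = ∫_A ν(t)^a dμ(a)`,
`G_t(x) = ρ_t((−∞,x])`, `G_t⁻(x) = ρ_t((−∞,x))`, for a.e. `t ∈ [0,T]` one has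
`v(t)^a(x) ∈ [a − G_t(x), a − G_t⁻(x)]` for `ν(t)⊗μ`-a.e. `(a,x)`, and
`‖v(t)‖_{L^∞(ν(t)⊗μ)} ≤ R_v + 2`. -/
theorem gradient_flow_is_measure_solution (Rv R T : ℝ) (hRv : 0 < Rv) (hR : 0 < R) (hT : 0 < T)
    (μ : Measure ℝ) [SigmaFinite μ] (hA : μ ((Set.Icc (-Rv) (Rv + 1))ᶜ) = 0)
    (h : ℝ → ℝ) (hh0 : ∀ a, 0 ≤ h a) (hhint : Integrable h μ) (hh1 : (∫ a, h a ∂μ) = 1)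
    (ν₀ : ℝ → Measure ℝ) (hν₀ : IsXR μ h R ν₀)
    (ν : ℝ → ℝ → Measure ℝ) (v : ℝ → ℝ → ℝ → ℝ)
    (hgf : IsGradientFlow μ h R T ν v ν₀) :
    ∀ᵐ t ∂(volume.restrict (Set.Icc (0 : ℝ) T)),
      (∀ᵐ p : ℝ × ℝ ∂(nuOtimes μ (ν t)),
        v t p.1 p.2 ∈ Set.Icc (p.1 - Gcdf μ (ν t) p.2) (p.1 - GcdfM μ (ν t) p.2)) ∧
      (∀ᵐ p : ℝ × ℝ ∂(nuOtimes μ (ν t)), |v t p.1 p.2| ≤ Rv + 2) := by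
  filter_upwards [hgf.subdiff, ae_restrict_mem measurableSet_Icc] with t hsub ht
  have hν := hgf.mem t ht
  have := hν.isProbabilityMeasure hh0 hhint hh1
  have hw : Measurable fun p : ℝ × ℝ => -(v t p.1 p.2) :=
    (hgf.vmeas.comp measurable_prodMk_left).neg
  have hmem : ∀ᵐ p : ℝ × ℝ ∂(nuOtimes μ (ν t)),
      v t p.1 p.2 ∈ Set.Icc (p.1 - Gcdf μ (ν t) p.2) (p.1 - GcdfM μ (ν t) p.2) := by
    filter_upwards [hsub.ae_mem_Icc hR hν hA hw] with p hp
    exact ⟨by linarith [hp.2], by linarith [hp.1]⟩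
  refine ⟨hmem, ?_⟩
  filter_upwards [hmem, hν.ae_fst measurableSet_Icc hA] with p hp hp1
  have hG : Gcdf μ (ν t) p.2 ≤ 1 := measureReal_le_one
  have hG' : 0 ≤ GcdfM μ (ν t) p.2 := ENNReal.toReal_nonneg
  exact abs_le.2 ⟨by linarith [hp.1, hp1.1], by linarith [hp.2, hp1.2]⟩
end
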